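/- For any fixed D > 0 and each n ∈ ℕ there exist constants c_{n,D} > 0 and C_{n,D} > 0, independent of the dimension d ∈ ℤ_+, such that for all d ∈ ℤ_+, all t with 0 < t ≤ D and all ξ ∈ 𝕋^d one has | t^{2n} ∂_t^n F_{ℤ^d} g_t(ξ) | ≤ C_{n,D} exp( -c_{n,D} e^{-π/t} |ξ|² ), where ∂_t^n denotes the n-th derivative in t of the smooth function t ↦ F_{ℤ^d} g_t(ξ) = Θ_t(ξ)/Θ_t(0) on (0,∞). -/

import Mathlib

open scoped ENNReal Real BigOperators
open Real

/-- The one-dimensional Theta function `θ_t(ζ) = Σ_{k∈ℤ} exp(-π(k-ζ)²t)`. -/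
noncomputable def theta (t ζ : ℝ) : ℝ :=
  ∑' k : ℤ, Real.exp (-π * ((k : ℝ) - ζ) ^ 2 * t)

/-- The d-dimensional Theta function `Θ_t(ξ) = Π_j θ_t(ξ_j)`. -/
noncomputable def bigTheta (d : ℕ) (t : ℝ) (ξ : Fin d → ℝ) : ℝ :=
  ∏ j, theta t (ξ j)

/-- The discrete normalized Gaussian kernel `g_t(n) = Θ_{1/t}(0)⁻¹ exp(-π|n|²/t)`. -/
noncomputable def gauss (d : ℕ) (t : ℝ) (n : Fin d → ℤ) : ℝ :=
  (bigTheta d (1 / t) 0)⁻¹ * Real.exp (-π * (∑ j, ((n j : ℝ)) ^ 2) / t)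

/-- The convolution operator `G_t f(x) = Σ_n g_t(n) f(x-n)` on ℤ^d. -/
noncomputable def gConv (d : ℕ) (t : ℝ) (f : (Fin d → ℤ) → ℂ) (x : Fin d → ℤ) : ℂ :=
  ∑' n : Fin d → ℤ, (gauss d t n : ℂ) * f (x - n)

/-- The ℓ^p norm (valued in ℝ≥0∞) of an ℝ≥0∞-valued function on ℤ^d. -/
noncomputable def lpNorm (d : ℕ) (p : ℝ) (F : (Fin d → ℤ) → ℝ≥0∞) : ℝ≥0∞ :=
  (∑' x : Fin d → ℤ, F x ^ p) ^ (1 / p)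

lemma my_hasSum_congr {α : Type*} [AddCommMonoid α] [TopologicalSpace α] {f g : ℤ → α} {a : α}
    (h : ∀ n, f n = g n) : HasSum f a ↔ HasSum g a := by
  rw [funext h]

/-- Dual theta series as a function of a complex variable. -/
noncomputable def JJ (ζ : ℝ) (w : ℂ) : ℂ := jacobiTheta₂ (ζ : ℂ) (Complex.I * w)

lemma JJ_hasSum (ζ : ℝ) {w : ℂ} (hw : 0 < w.re) :
    HasSum (fun n : ℤ => Complex.exp (-π * (n : ℂ) ^ 2 * w) * ((Real.cos (2 * π * n * ζ) : ℝ) : ℂ))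
      (JJ ζ w) := by
  have hτ : 0 < (Complex.I * w).im := by simpa using hw
  have h1 := hasSum_jacobiTheta₂_term (ζ : ℂ) hτ
  have h2 := hasSum_jacobiTheta₂_term (-ζ : ℂ) hτ
  rw [jacobiTheta₂_neg_left] at h2
  have h3 := (h1.add h2).div_const 2
  have h4 : (jacobiTheta₂ (ζ : ℂ) (Complex.I * w) + jacobiTheta₂ (ζ : ℂ) (Complex.I * w)) / 2
    = JJ ζ w := by unfold JJ; ring
  rw [h4] at h3
  refine (my_hasSum_congr fun n => ?_).mpr h3
  unfold jacobiTheta₂_term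
  rw [Complex.exp_add, Complex.exp_add]
  have e1 : (π : ℂ) * Complex.I * (n : ℂ) ^ 2 * (Complex.I * w) = -π * (n : ℂ) ^ 2 * w := by
    linear_combination (π * (n : ℂ) ^ 2 * w) * Complex.I_mul_I
  rw [e1]
  push_cast
  rw [Complex.cos]
  rw [show 2 * (π : ℂ) * n * ζ * Complex.I = 2 * π * Complex.I * n * ζ by ring,
    show -(2 * (π : ℂ) * n * ζ) * Complex.I = 2 * π * Complex.I * n * -ζ by ring]
  ring

lemma JJ_diff (ζ : ℝ) {w : ℂ} (hw : 0 < w.re) : DifferentiableAt ℂ (JJ ζ) w := by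
  have hτ : 0 < (Complex.I * w).im := by simpa using hw
  have h := differentiableAt_jacobiTheta₂_snd (ζ : ℂ) hτ
  exact h.comp w (by fun_prop)

lemma JJ_theta (ζ : ℝ) {t : ℝ} (ht : 0 < t) :
    JJ ζ ((1 / t : ℝ) : ℂ) = ((1 / (1 / t) ^ (1 / 2 : ℝ) * theta t ζ : ℝ) : ℂ) := by
  have hu : 0 < 1 / t := by positivity
  have h := Complex.tsum_exp_neg_quadratic (a := ((1 / t : ℝ) : ℂ)) (by simpa using ht)
    (Complex.I * ζ)
  have e : JJ ζ ((1 / t : ℝ) : ℂ) = ∑' n : ℤ, Complex.exp (-π * ((1 / t : ℝ) : ℂ) * (n : ℂ) ^ 2 +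
      2 * π * (Complex.I * ζ) * n) := by
    unfold JJ jacobiTheta₂
    refine tsum_congr fun n => ?_
    unfold jacobiTheta₂_term
    congr 1
    linear_combination (π * (n : ℂ) ^ 2 * ((1 / t : ℝ) : ℂ)) * Complex.I_mul_I
  rw [e, h]
  unfold theta
  rw [Complex.ofReal_mul, Complex.ofReal_tsum]
  congr 1
  · generalize 1 / t = u at hu
    rw [Complex.ofReal_div, Complex.ofReal_cpow hu.le]
    norm_num
  · refine tsum_congr fun n => ?_
    rw [Complex.ofReal_exp]
    congr 1
    have : (t : ℂ) ≠ 0 := by exact_mod_cast ht.ne'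
    push_cast
    field_simp
    linear_combination (-ζ * (2 * n + Complex.I ^ 2 * ζ - ζ) ) * Complex.I_sq

lemma norm_term_diff (m u : ℝ) (hm : 0 ≤ m) (w : ℂ) (δ : ℝ) (hw : ‖w - u‖ ≤ δ) :
    ‖Complex.exp (-m * w) - Complex.exp (-m * u)‖ ≤ m * δ * Real.exp (-m * (u - δ)) := by
  have hδ : 0 ≤ δ := (norm_nonneg _).trans hw
  have e : Complex.exp (-m * w) - Complex.exp (-m * u) =
      Complex.exp (-m * u) * (Complex.exp (-m * (w - u)) - 1) := by
    rw [mul_sub, ← Complex.exp_add]; ring_nf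
  have h := Complex.norm_exp_sub_sum_le_norm_mul_exp (-m * (w - u)) 1
  simp only [Finset.range_one, Finset.sum_singleton, pow_zero, Nat.factorial_zero, Nat.cast_one,
    div_one, pow_one] at h
  have h2 : ‖-(m : ℂ) * (w - u)‖ ≤ m * δ := by
    rw [norm_mul, norm_neg, Complex.norm_real, Real.norm_of_nonneg hm]
    gcongr
  rw [e, norm_mul, Complex.norm_exp]
  have h3 : (-(m : ℂ) * u).re = -m * u := by simp
  rw [h3]
  calc Real.exp (-m * u) * _ ≤ Real.exp (-m * u) * (m * δ * Real.exp (m * δ)) := by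
        gcongr
        refine h.trans ?_
        gcongr
    _ = _ := by
        rw [show -m * (u - δ) = -m * u + m * δ by ring, Real.exp_add]; ring

lemma real_iter (F : ℝ → ℝ) (G : ℂ → ℂ) (hG : ∀ s : ℝ, 0 < s → AnalyticAt ℂ G s)
    (h : ∀ s : ℝ, 0 < s → (F s : ℂ) = G s) (n : ℕ) :
    ∀ s : ℝ, 0 < s → ((iteratedDeriv n F s : ℝ) : ℂ) = iteratedDeriv n G s := by
  induction n with
  | zero => simpa using h
  | succ k ih =>
    intro s hs
    rw [iteratedDeriv_succ, iteratedDeriv_succ]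
    have ha : AnalyticAt ℂ (iteratedDeriv k G) s := by
      rw [iteratedDeriv_eq_iterate]
      exact (hG s hs).iterated_deriv k
    have h1 := ha.differentiableAt.hasDerivAt.comp_ofReal
    have h2 : (fun y : ℝ => iteratedDeriv k G y) =ᶠ[nhds s]
        fun y : ℝ => ((iteratedDeriv k F y : ℝ) : ℂ) := by
      filter_upwards [lt_mem_nhds hs] with y hy using (ih y hy).symm
    have h3 := h1.congr_of_eventuallyEq h2.symm
    have h4 : HasDerivAt (iteratedDeriv k F) (deriv (iteratedDeriv k G) s).re s := by
      have := Complex.reCLM.hasFDerivAt.comp_hasDerivAt s h3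
      simpa [Function.comp_def] using this
    rw [h4.deriv]
    exact h4.ofReal_comp.unique h3

/-- majorant series -/
noncomputable def SS (b : ℝ) : ℝ := ∑' n : ℤ, (n : ℝ) ^ 4 * Real.exp (-π * (b / 2 * (n : ℝ) ^ 2))

lemma SS_summable {b : ℝ} (hb : 0 < b) :
    Summable (fun n : ℤ => (n : ℝ) ^ 4 * Real.exp (-π * (b / 2 * (n : ℝ) ^ 2))) := by
  have h := summable_pow_mul_jacobiTheta₂_term_bound 0 (half_pos hb) 4
  refine h.congr fun n => ?_
  have e : ((|n| : ℤ) : ℝ) ^ 4 = (n : ℝ) ^ 4 := by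
    push_cast
    exact (by decide : Even 4).pow_abs _
  rw [e]; simp

lemma SS_pos {b : ℝ} (hb : 0 < b) : 0 < SS b := by
  refine (SS_summable hb).tsum_pos (fun n => by positivity) 1 ?_
  simp only [Int.cast_one]
  positivity

lemma int_sq_le (n : ℤ) : (n : ℝ) ^ 2 ≤ (n : ℝ) ^ 4 := by
  rcases eq_or_ne n 0 with rfl | hn
  · simp
  · have h1 : (1 : ℝ) ≤ (n : ℝ) ^ 2 := by
      have : (1 : ℤ) ≤ n ^ 2 := by
        have := sq_pos_of_ne_zero hn
        omega
      exact_mod_cast this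
    nlinarith

lemma exp_bound {b u δ : ℝ} (hu : b ≤ u) (hδ : δ ≤ b / 2) (n : ℤ) (hn : n ≠ 0) :
    Real.exp (-(π * (n : ℝ) ^ 2) * (u - δ)) ≤
      Real.exp (π * b) * Real.exp (-π * u) * Real.exp (-π * (b / 2 * (n : ℝ) ^ 2)) := by
  have h1 : (1 : ℝ) ≤ (n : ℝ) ^ 2 := by
    have : (1 : ℤ) ≤ n ^ 2 := by
      have := sq_pos_of_ne_zero hn
      omega
    exact_mod_cast this
  rw [← Real.exp_add, ← Real.exp_add]
  apply Real.exp_le_exp.mpr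
  have h2 : 0 ≤ ((n : ℝ) ^ 2 - 1) * (u - b) + (n : ℝ) ^ 2 * (b / 2 - δ) :=
    add_nonneg (mul_nonneg (by linarith) (by linarith)) (mul_nonneg (by linarith) (by linarith))
  nlinarith [mul_nonneg Real.pi_pos.le h2]

lemma cos_low (n : ℤ) (ζ : ℝ) : |1 - Real.cos (2 * π * n * ζ)| ≤ 2 * π ^ 2 * (n : ℝ) ^ 2 * ζ ^ 2 := by
  rw [abs_of_nonneg (by linarith [Real.cos_le_one (2 * π * n * ζ)])]
  have := Real.one_sub_sq_div_two_le_cos (x := 2 * π * n * ζ)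
  nlinarith

lemma e_form (n : ℤ) (w : ℂ) : Complex.exp (-π * (n : ℂ) ^ 2 * w) =
    Complex.exp (-((π * (n : ℝ) ^ 2 : ℝ) : ℂ) * w) := by
  congr 1; push_cast; ring

lemma JJ0_hasSum {w : ℂ} (hw : 0 < w.re) :
    HasSum (fun n : ℤ => Complex.exp (-((π * (n : ℝ) ^ 2 : ℝ) : ℂ) * w)) (JJ 0 w) := by
  refine (my_hasSum_congr fun n => ?_).mpr (JJ_hasSum 0 hw)
  rw [e_form]; simp

lemma NN_hasSum (ζ : ℝ) {w : ℂ} (hw : 0 < w.re) :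
    HasSum (fun n : ℤ => Complex.exp (-((π * (n : ℝ) ^ 2 : ℝ) : ℂ) * w) *
      ((1 - Real.cos (2 * π * n * ζ) : ℝ) : ℂ)) (JJ 0 w - JJ ζ w) := by
  refine (my_hasSum_congr fun n => ?_).mpr ((JJ0_hasSum hw).sub (JJ_hasSum ζ hw))
  rw [e_form]; push_cast; ring

lemma L2 {b u δ : ℝ} (hb : 0 < b) (hu : b ≤ u) (hδ : δ ≤ b / 2) {w : ℂ} (hw : ‖w - u‖ ≤ δ)
    (hw0 : 0 < w.re) : ‖JJ 0 w - JJ 0 u‖ ≤ π * δ * SS b := by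
  have hδ0 : 0 ≤ δ := (norm_nonneg _).trans hw
  have h := (JJ0_hasSum hw0).sub (JJ0_hasSum (w := (u : ℂ)) (by simpa using hb.trans_le hu))
  rw [← h.tsum_eq]
  refine tsum_of_norm_bounded ((SS_summable hb).hasSum.mul_left (π * δ)) fun n => ?_
  refine (norm_term_diff _ u (by positivity) w δ hw).trans ?_
  have h1 : Real.exp (-(π * (n : ℝ) ^ 2) * (u - δ)) ≤ Real.exp (-π * (b / 2 * (n : ℝ) ^ 2)) := by
    apply Real.exp_le_exp.mpr
    have : 0 ≤ π * (n : ℝ) ^ 2 * (u - δ - b / 2) := mul_nonneg (by positivity) (by linarith)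
    nlinarith
  have h2 := int_sq_le n
  calc π * (n : ℝ) ^ 2 * δ * Real.exp (-(π * (n : ℝ) ^ 2) * (u - δ))
      ≤ π * (n : ℝ) ^ 4 * δ * Real.exp (-π * (b / 2 * (n : ℝ) ^ 2)) := by gcongr
    _ = _ := by ring

lemma L3 {b u δ : ℝ} (hb : 0 < b) (hu : b ≤ u) (hδ : δ ≤ b / 2) {w : ℂ} (hw : ‖w - u‖ ≤ δ)
    (hw0 : 0 < w.re) (ζ : ℝ) : ‖(JJ 0 w - JJ ζ w) - (JJ 0 u - JJ ζ u)‖ ≤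
      (2 * π ^ 3 * Real.exp (π * b) * δ * ζ ^ 2 * Real.exp (-π * u)) * SS b := by
  have hδ0 : 0 ≤ δ := (norm_nonneg _).trans hw
  have h := (NN_hasSum ζ hw0).sub (NN_hasSum ζ (w := (u : ℂ)) (by simpa using hb.trans_le hu))
  rw [← h.tsum_eq]
  refine tsum_of_norm_bounded ((SS_summable hb).hasSum.mul_left _) fun n => ?_
  rcases eq_or_ne n 0 with rfl | hn
  · simp
  rw [← sub_mul, norm_mul, Complex.norm_real, Real.norm_eq_abs]
  calc _ ≤ (π * (n : ℝ) ^ 2 * δ * (Real.exp (π * b) * Real.exp (-π * u) *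
            Real.exp (-π * (b / 2 * (n : ℝ) ^ 2)))) * (2 * π ^ 2 * (n : ℝ) ^ 2 * ζ ^ 2) := by
        gcongr
        · refine (norm_term_diff _ u (by positivity) w δ hw).trans ?_
          gcongr
          exact exp_bound hu hδ n hn
        · exact cos_low n ζ
    _ = _ := by ring

lemma L4 {b u : ℝ} (hb : 0 < b) (hu : b ≤ u) (ζ : ℝ) : ‖JJ 0 u - JJ ζ u‖ ≤
      (2 * π ^ 2 * Real.exp (π * b) * ζ ^ 2 * Real.exp (-π * u)) * SS b := by
  have h := (NN_hasSum ζ (w := (u : ℂ)) (by simpa using hb.trans_le hu))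
  rw [← h.tsum_eq]
  refine tsum_of_norm_bounded ((SS_summable hb).hasSum.mul_left _) fun n => ?_
  rcases eq_or_ne n 0 with rfl | hn
  · simp
  rw [norm_mul, Complex.norm_real, Real.norm_eq_abs, Complex.norm_exp]
  have e : (-((π * (n : ℝ) ^ 2 : ℝ) : ℂ) * u).re = -(π * (n : ℝ) ^ 2) * (u - 0) := by
    rw [← Complex.ofReal_neg, ← Complex.ofReal_mul, Complex.ofReal_re, sub_zero]
  rw [e]
  have h2 := int_sq_le n
  calc _ ≤ (Real.exp (π * b) * Real.exp (-π * u) *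
            Real.exp (-π * (b / 2 * (n : ℝ) ^ 2))) * (2 * π ^ 2 * (n : ℝ) ^ 4 * ζ ^ 2) := by
        gcongr
        · exact exp_bound hu (by linarith) n hn
        · exact (cos_low n ζ).trans (by gcongr)
    _ = _ := by ring

lemma JJ0_re {u : ℝ} (hu : 0 < u) :
    HasSum (fun n : ℤ => Real.exp (-(π * (n : ℝ) ^ 2) * u)) (JJ 0 u).re := by
  have h := Complex.hasSum_re (JJ0_hasSum (w := (u : ℂ)) (by simpa using hu))
  refine (my_hasSum_congr fun n => ?_).mpr h
  rw [← Complex.ofReal_neg, ← Complex.ofReal_mul, ← Complex.ofReal_exp, Complex.ofReal_re]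

lemma NN_re (ζ : ℝ) {u : ℝ} (hu : 0 < u) :
    HasSum (fun n : ℤ => Real.exp (-(π * (n : ℝ) ^ 2) * u) * (1 - Real.cos (2 * π * n * ζ)))
      ((JJ 0 u).re - (JJ ζ u).re) := by
  have h := Complex.hasSum_re (NN_hasSum ζ (w := (u : ℂ)) (by simpa using hu))
  rw [Complex.sub_re] at h
  refine (my_hasSum_congr fun n => ?_).mpr h
  rw [← Complex.ofReal_neg, ← Complex.ofReal_mul, ← Complex.ofReal_exp, ← Complex.ofReal_mul,
    Complex.ofReal_re]

lemma L5 {u : ℝ} (hu : 0 < u) : 1 ≤ (JJ 0 u).re := by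
  have h := le_hasSum (JJ0_re hu) 0 (fun n _ => by positivity)
  simpa using h

lemma L5' {b u : ℝ} (hb : 0 < b) (hu : b ≤ u) : (JJ 0 u).re ≤ (JJ 0 b).re := by
  refine hasSum_le (fun n => ?_) (JJ0_re (hb.trans_le hu)) (JJ0_re hb)
  apply Real.exp_le_exp.mpr
  have : 0 ≤ π * (n : ℝ) ^ 2 * (u - b) := mul_nonneg (by positivity) (by linarith)
  nlinarith

lemma L6 {u : ℝ} (hu : 0 < u) {ζ : ℝ} (hζ : |ζ| ≤ 1 / 2) :
    8 * ζ ^ 2 * Real.exp (-π * u) ≤ (JJ 0 u).re - (JJ ζ u).re := by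
  have h := le_hasSum (NN_re ζ hu) 1 (fun n _ => mul_nonneg (by positivity)
    (by linarith [Real.cos_le_one (2 * π * n * ζ)]))
  have h2 := Real.cos_le_one_sub_mul_cos_sq (x := 2 * π * ζ) (by
    rw [abs_mul, abs_of_pos Real.two_pi_pos]
    nlinarith [Real.pi_pos])
  have e : 2 / π ^ 2 * (2 * π * ζ) ^ 2 = 8 * ζ ^ 2 := by
    have := Real.pi_ne_zero
    field_simp; ring
  rw [e] at h2
  simp only [Int.cast_one, one_pow, mul_one] at h
  refine le_trans ?_ h
  nlinarith [Real.exp_pos (-π * u)]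

lemma key (D : ℝ) (hD : 0 < D) : ∃ δ c : ℝ, 0 < δ ∧ 0 < c ∧ ∀ t : ℝ, 0 < t → t ≤ D → ∀ w : ℂ,
    ‖w - ((1 / t : ℝ) : ℂ)‖ ≤ δ → 0 < w.re ∧ JJ 0 w ≠ 0 ∧ ∀ ζ : ℝ, |ζ| ≤ 1 / 2 →
      ‖JJ ζ w / JJ 0 w‖ ≤ Real.exp (-c * Real.exp (-π / t) * ζ ^ 2) := by
  obtain ⟨b, hbD⟩ : ∃ b, b = 1 / D := ⟨_, rfl⟩
  have hb : 0 < b := by rw [hbD]; positivity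
  set S := SS b with hS
  have hS0 : 0 < S := SS_pos hb
  set K := (JJ 0 b).re with hK
  have hK1 : 1 ≤ K := L5 hb
  obtain ⟨M, hM⟩ : ∃ M, M = 4 * π ^ 3 * Real.exp (π * b) * S +
    4 * π ^ 2 * Real.exp (π * b) * S * (π * S) := ⟨_, rfl⟩
  have hM0 : 0 < M := by rw [hM]; positivity
  refine ⟨min (b / 2) (min (1 / (2 * π * S)) (4 / (K * M))), 4 / K, by positivity, by positivity, ?_⟩
  intro t ht htD w hw
  obtain ⟨u, hu⟩ : ∃ u, u = 1 / t := ⟨_, rfl⟩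
  rw [← hu] at hw
  have hbu : b ≤ u := by rw [hbD, hu]; exact one_div_le_one_div_of_le ht htD
  have hu0 : 0 < u := hb.trans_le hbu
  obtain ⟨δ, hδ⟩ : ∃ δ, δ = min (b / 2) (min (1 / (2 * π * S)) (4 / (K * M))) := ⟨_, rfl⟩
  rw [← hδ] at hw
  have hδ1 : δ ≤ b / 2 := hδ ▸ min_le_left _ _
  have hδ2 : δ ≤ 1 / (2 * π * S) := hδ ▸ (min_le_right _ _).trans (min_le_left _ _)
  have hδ3 : δ ≤ 4 / (K * M) := hδ ▸ (min_le_right _ _).trans (min_le_right _ _)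
  have hδ0 : 0 ≤ δ := (norm_nonneg _).trans hw
  have hw0 : 0 < w.re := by
    have h1 := (Complex.abs_re_le_norm (w - u)).trans hw
    rw [Complex.sub_re, Complex.ofReal_re] at h1
    have := (abs_le.mp h1).1
    linarith
  have hT := L2 hb hbu hδ1 hw hw0
  rw [← hS] at hT
  have hTs : π * δ * S ≤ 1 / 2 := by
    rw [le_div_iff₀ (by positivity)] at hδ2
    linarith
  have hTu : 1 ≤ ‖JJ 0 u‖ := (L5 hu0).trans ((le_abs_self _).trans (Complex.abs_re_le_norm _))
  have hTw : 1 / 2 ≤ ‖JJ 0 w‖ := by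
    have := norm_sub_norm_le (JJ 0 u) (JJ 0 w)
    rw [norm_sub_rev] at this
    linarith
  have hTu0 : JJ 0 u ≠ 0 := norm_pos_iff.mp (by linarith)
  have hTw0 : JJ 0 w ≠ 0 := norm_pos_iff.mp (by linarith)
  refine ⟨hw0, hTw0, fun ζ hζ => ?_⟩
  have hq : Real.exp (-π / t) = Real.exp (-π * u) := by rw [hu]; congr 1; ring
  rw [hq]
  obtain ⟨q, hqq⟩ : ∃ q, q = Real.exp (-π * u) := ⟨_, rfl⟩
  have h3 := L3 hb hbu hδ1 hw hw0 ζ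
  have h4 := L4 hb hbu ζ
  have h6 := L6 hu0 hζ
  rw [← hqq, ← hS] at h3 h4
  rw [← hqq] at h6 ⊢
  have hq0 : 0 < q := hqq ▸ Real.exp_pos _
  -- the real part
  have hreal : ‖JJ ζ u / JJ 0 u‖ ≤ 1 - 8 / K * ζ ^ 2 * q := by
    have hz : ∀ z : ℝ, ‖JJ z u‖ = (JJ z u).re := by
      intro z
      rw [hu, JJ_theta z ht, Complex.norm_real, Complex.ofReal_re, Real.norm_of_nonneg]
      unfold theta
      exact mul_nonneg (by positivity) (tsum_nonneg fun n => by positivity)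
    have hle : (JJ 0 u).re ≤ K := L5' hb hbu
    have h1 := L5 hu0
    rw [norm_div, hz, hz, div_le_iff₀ (by linarith)]
    have : 8 / K * ζ ^ 2 * q * (JJ 0 u).re ≤ 8 * ζ ^ 2 * q := by
      calc 8 / K * ζ ^ 2 * q * (JJ 0 u).re ≤ 8 / K * ζ ^ 2 * q * K := by gcongr
        _ = _ := by field_simp
    linarith
  have hdiff : ‖JJ ζ w / JJ 0 w - JJ ζ u / JJ 0 u‖ ≤ 4 / K * ζ ^ 2 * q := by
    have e : JJ ζ w / JJ 0 w - JJ ζ u / JJ 0 u =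
        -((JJ 0 w - JJ ζ w) - (JJ 0 u - JJ ζ u)) / JJ 0 w +
        (JJ 0 u - JJ ζ u) * (JJ 0 w - JJ 0 u) / (JJ 0 u * JJ 0 w) := by
      field_simp; ring
    rw [e]
    refine (norm_add_le _ _).trans ?_
    rw [norm_div, norm_neg, norm_div, norm_mul, norm_mul]
    have hi : ∀ x : ℝ, 0 ≤ x → x / ‖JJ 0 w‖ ≤ 2 * x := by
      intro x hx
      rw [div_le_iff₀ (by linarith)]
      nlinarith
    have hj : ∀ x : ℝ, 0 ≤ x → x / (‖JJ 0 u‖ * ‖JJ 0 w‖) ≤ 2 * x := by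
      intro x hx
      have : 1 / 2 ≤ ‖JJ 0 u‖ * ‖JJ 0 w‖ := by nlinarith
      rw [div_le_iff₀ (by linarith)]
      nlinarith
    refine (add_le_add (hi _ (norm_nonneg _)) (hj _ (by positivity))).trans ?_
    calc _ ≤ 2 * ((2 * π ^ 3 * Real.exp (π * b) * δ * ζ ^ 2 * q) * S) +
          2 * (((2 * π ^ 2 * Real.exp (π * b) * ζ ^ 2 * q) * S) * (π * δ * S)) := by gcongr
      _ = δ * M * (ζ ^ 2 * q) := by rw [hM]; ring
      _ ≤ 4 / K * (ζ ^ 2 * q) := by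
          have : δ * M ≤ 4 / K := by
            calc δ * M ≤ 4 / (K * M) * M := by gcongr
              _ = _ := by field_simp
          gcongr
      _ = _ := by ring
  have hfin : ‖JJ ζ w / JJ 0 w‖ ≤ 1 - 4 / K * ζ ^ 2 * q := by
    have := norm_sub_norm_le (JJ ζ w / JJ 0 w) (JJ ζ u / JJ 0 u)
    have e8 : 8 / K * ζ ^ 2 * q = 2 * (4 / K * ζ ^ 2 * q) := by ring
    linarith
  have := Real.add_one_le_exp (-(4 / K) * q * ζ ^ 2)
  refine hfin.trans (le_trans (le_of_eq ?_) this)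
  ring

/-- Derivative bounds for `F_{ℤ^d} g_t(ξ) = Θ_t(ξ)/Θ_t(0)` at small scales: for any fixed `D > 0`
and each `n ∈ ℕ` there are constants `c_{n,D} > 0` and `C_{n,D} > 0`, independent of the dimension
`d`, such that for all `d ∈ ℤ_+`, `0 < t ≤ D` and `ξ ∈ 𝕋^d`,
`|t^{2n} ∂_t^n F_{ℤ^d} g_t(ξ)| ≤ C_{n,D} exp(-c_{n,D} e^{-π/t} |ξ|²)`. -/
theorem fourier_gauss_deriv_small_scales (D : ℝ) (hD : 0 < D) (n : ℕ) :
    ∃ c C : ℝ, 0 < c ∧ 0 < C ∧ ∀ d : ℕ, 0 < d → ∀ t : ℝ, 0 < t → t ≤ D →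
      ∀ ξ : Fin d → ℝ, (∀ j, ξ j ∈ Set.Ico (-(1/2) : ℝ) (1/2)) →
      |t ^ (2 * n) * iteratedDeriv n (fun s => bigTheta d s ξ / bigTheta d s 0) t| ≤
        C * Real.exp (-c * Real.exp (-π / t) * ∑ j, ξ j ^ 2) := by
  obtain ⟨δ, c, hδ, hc, hkey⟩ := key D hD
  obtain ⟨ε, hε⟩ : ∃ ε, ε = min (δ / 2) (1 / (2 * D)) := ⟨_, rfl⟩
  have hε0 : 0 < ε := by rw [hε]; positivity
  have hε1 : ε ≤ δ / 2 := hε ▸ min_le_left _ _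
  have hε2 : ε ≤ 1 / (2 * D) := hε ▸ min_le_right _ _
  refine ⟨c, n.factorial / ε ^ n, hc, by positivity, ?_⟩
  intro d _ t ht htD ξ hξ
  have hξ' : ∀ j, |ξ j| ≤ 1 / 2 := fun j => abs_le.mpr ⟨by linarith [(hξ j).1], (hξ j).2.le⟩
  let G : ℂ → ℂ := fun z => ∏ j, JJ (ξ j) z⁻¹ / JJ 0 z⁻¹
  have hdiff : ∀ z : ℂ, z ≠ 0 → 0 < (z⁻¹).re → JJ 0 z⁻¹ ≠ 0 → DifferentiableAt ℂ G z := by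
    intro z hz0 hz h0
    have hi : DifferentiableAt ℂ (fun z : ℂ => z⁻¹) z := differentiableAt_inv hz0
    refine DifferentiableAt.fun_finsetProd fun j _ => ?_
    exact DifferentiableAt.div (c := fun z : ℂ => JJ (ξ j) z⁻¹) (d := fun z : ℂ => JJ 0 z⁻¹)
      ((JJ_diff (ξ j) hz).comp z hi) ((JJ_diff 0 hz).comp z hi) h0
  have hGan : ∀ s : ℝ, 0 < s → AnalyticAt ℂ G s := by
    intro s hs
    rw [Complex.analyticAt_iff_eventually_differentiableAt]
    have hs0 : (s : ℂ) ≠ 0 := by exact_mod_cast hs.ne'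
    have e : (s : ℂ)⁻¹ = ((1 / s : ℝ) : ℂ) := by push_cast; rw [one_div]
    have hre : 0 < ((s : ℂ)⁻¹).re := by rw [e, Complex.ofReal_re]; positivity
    have hne : JJ 0 (s : ℂ)⁻¹ ≠ 0 := by
      intro h
      have h5 := L5 (u := 1 / s) (by positivity)
      rw [← e, h] at h5
      norm_num at h5
    have hci : ContinuousAt (fun z : ℂ => z⁻¹) (s : ℂ) := continuousAt_inv₀ hs0
    have hcr : ContinuousAt (fun z : ℂ => (z⁻¹).re) (s : ℂ) :=
      Complex.continuous_re.continuousAt.comp hci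
    have hcJ : ContinuousAt (fun z : ℂ => JJ 0 z⁻¹) (s : ℂ) :=
      ContinuousAt.comp (f := fun z : ℂ => z⁻¹) (JJ_diff 0 hre).continuousAt hci
    filter_upwards [isOpen_ne.mem_nhds hs0, hcr.eventually (lt_mem_nhds hre),
      hcJ.eventually (isOpen_ne.mem_nhds hne)] with z h1 h2 h3 using hdiff z h1 h2 h3
  have hFG : ∀ s : ℝ, 0 < s → ((bigTheta d s ξ / bigTheta d s 0 : ℝ) : ℂ) = G s := by
    intro s hs
    have e : (s : ℂ)⁻¹ = ((1 / s : ℝ) : ℂ) := by push_cast; rw [one_div]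
    simp only [G, bigTheta]
    rw [← Finset.prod_div_distrib, Complex.ofReal_prod]
    refine Finset.prod_congr rfl fun j _ => ?_
    rw [e, JJ_theta _ hs, JJ_theta _ hs, ← Complex.ofReal_div, mul_div_mul_left]
    · rfl
    · positivity
  have hit := real_iter _ G hGan hFG n t ht
  have hR : 0 < ε * t ^ 2 := by positivity
  -- control of the disc
  have hdisc : ∀ z : ℂ, ‖z - t‖ ≤ ε * t ^ 2 → z ≠ 0 ∧ ‖z⁻¹ - ((1 / t : ℝ) : ℂ)‖ ≤ δ := by
    intro z hz
    have ht0 : (t : ℂ) ≠ 0 := by exact_mod_cast ht.ne'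
    have hεt : ε * t ≤ 1 / 2 := by
      calc ε * t ≤ 1 / (2 * D) * D := by gcongr
        _ = 1 / 2 := by field_simp
    have hzn : t / 2 ≤ ‖z‖ := by
      have h1 := norm_sub_norm_le (t : ℂ) z
      rw [norm_sub_rev, Complex.norm_real, Real.norm_of_nonneg ht.le] at h1
      nlinarith
    have hz0 : z ≠ 0 := norm_pos_iff.mp (by linarith)
    refine ⟨hz0, ?_⟩
    have e : z⁻¹ - ((1 / t : ℝ) : ℂ) = -(z - t) / (z * t) := by
      push_cast; field_simp; ring
    rw [e, norm_div, norm_neg, norm_mul, Complex.norm_real, Real.norm_of_nonneg ht.le,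
      div_le_iff₀ (by positivity)]
    calc ‖z - t‖ ≤ ε * t ^ 2 := hz
      _ ≤ δ / 2 * t ^ 2 := by gcongr
      _ = δ * (t / 2 * t) := by ring
      _ ≤ δ * (‖z‖ * t) := by gcongr
  have hDC : DiffContOnCl ℂ G (Metric.ball (t : ℂ) (ε * t ^ 2)) := by
    apply DifferentiableOn.diffContOnCl
    intro z hz
    have hz' := Metric.closure_ball_subset_closedBall hz
    rw [Metric.mem_closedBall, dist_eq_norm] at hz'
    obtain ⟨h0, h1⟩ := hdisc z hz'
    obtain ⟨h2, h3, _⟩ := hkey t ht htD _ h1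
    exact (hdiff z h0 h2 h3).differentiableWithinAt
  have hbound : ∀ z ∈ Metric.sphere (t : ℂ) (ε * t ^ 2),
      ‖G z‖ ≤ Real.exp (-c * Real.exp (-π / t) * ∑ j, ξ j ^ 2) := by
    intro z hz
    rw [mem_sphere_iff_norm] at hz
    obtain ⟨h0, h1⟩ := hdisc z hz.le
    obtain ⟨h2, h3, h4⟩ := hkey t ht htD _ h1
    simp only [G]
    rw [norm_prod, Finset.mul_sum, Real.exp_sum]
    exact Finset.prod_le_prod (fun _ _ => norm_nonneg _) fun j _ => h4 (ξ j) (hξ' j)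
  have hC := Complex.norm_iteratedDeriv_le_of_forall_mem_sphere_norm_le n hR hDC hbound
  rw [← hit, Complex.norm_real, Real.norm_eq_abs] at hC
  rw [abs_mul, abs_of_pos (by positivity : 0 < t ^ (2 * n))]
  calc _ ≤ t ^ (2 * n) * (n.factorial * Real.exp (-c * Real.exp (-π / t) * ∑ j, ξ j ^ 2) /
        (ε * t ^ 2) ^ n) := by gcongr
    _ = _ := by
      rw [mul_pow, ← pow_mul]
      field_simp
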